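/- arXiv:2603.18969 — 14 statements merged into one kernel-verified Lean document; each statement's English description precedes it below -/
import Mathlib

section
/- Assume a > 0, b < 0, l, η, σ > 0, μ > r, θ > 0, m, r, ρ ∈ ℝ, φ > 0 with |ρ + φ| < 1 and |ρ − φ| < 1, and set ψ := θlσ/(η(μ−r)). If φ ≥ ψ − ρ, then the supremum over x ≥ 0 and y ∈ ℝ of the infimum over ξ ∈ [−φ, φ] of f(x, y, ξ) equals a·m·r − (a²/(2b))·((μ−r)/σ)², and it is attained at x* = 0 and y* = −(a/b)·(μ−r)/σ² (at which point f is independent of ξ). -/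
/-- Zero-underwriting regime of the robust HJBI Hamiltonian: if `φ ≥ ψ - ρ`, the
sup over `x ≥ 0, y` of the inf over `ξ ∈ [-φ, φ]` of the Hamiltonian integrand
equals `a m r - (a²/(2b)) ((μ-r)/σ)²`, attained at `x* = 0`,
`y* = -(a/b)(μ-r)/σ²`, at which point `f` is independent of `ξ`. -/
theorem stmt_1 (a b l η σ μ r θ m ρ φ : ℝ)
    (ha : 0 < a) (hb : b < 0)
    (hl : 0 < l) (hη : 0 < η) (hσ : 0 < σ) (hμr : r < μ) (hθ : 0 < θ) (hφ : 0 < φ)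
    (hup : |ρ + φ| < 1) (hlo : |ρ - φ| < 1)
    (hcase : φ ≥ θ * l * σ / (η * (μ - r)) - ρ) :
    let f : ℝ → ℝ → ℝ → ℝ := fun x y ξ =>
      a * (x * θ * l + y * (μ - r) + m * r)
        + b / 2 * (x ^ 2 * η ^ 2 + 2 * (ρ + ξ) * x * η * y * σ + y ^ 2 * σ ^ 2)
    let v := a * m * r - a ^ 2 / (2 * b) * ((μ - r) / σ) ^ 2
    let xs : ℝ := 0
    let ys : ℝ := -(a / b) * (μ - r) / σ ^ 2
    (∀ ξ ∈ Set.Icc (-φ) φ, f xs ys ξ = v) ∧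
    (∀ x, 0 ≤ x → ∀ y : ℝ, sInf ((fun ξ => f x y ξ) '' Set.Icc (-φ) φ) ≤ v) := by
  intro f v xs ys
  have hb' : b ≠ 0 := hb.ne
  have hσ' : σ ≠ 0 := hσ.ne'
  refine ⟨fun ξ _ => ?_, fun x hx y => ?_⟩
  · simp only [f, v, xs, ys]
    field_simp
    ring
  have hcont : Continuous fun ξ => f x y ξ := by
    simp only [f]
    fun_prop
  have hbdd : BddBelow ((fun ξ => f x y ξ) '' Set.Icc (-φ) φ) :=
    (isCompact_Icc.image hcont).bddBelow
  refine (csInf_le hbdd ⟨φ, ⟨by linarith, le_rfl⟩, rfl⟩).trans ?_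
  have hP : 0 < μ - r := sub_pos.2 hμr
  obtain ⟨hc₁, hc₂⟩ := abs_lt.1 hup
  -- `k` is the optimal volatility-scaled stock position
  obtain ⟨k, hk⟩ : ∃ k, k = -(a * (μ - r)) / (b * σ) := ⟨_, rfl⟩
  have haP : a * (μ - r) = -b * σ * k := by
    rw [hk]
    field_simp
  have hv : v = a * m * r - b / 2 * k ^ 2 := by
    simp only [v, hk]
    field_simp
  have hprofit : θ * l * σ ≤ (ρ + φ) * (η * (μ - r)) :=
    (div_le_iff₀ (mul_pos hη hP)).1 (by linarith)
  have hins : a * (θ * l) ≤ -b * k * (ρ + φ) * η := by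
    refine le_of_mul_le_mul_right ?_ hσ
    calc a * (θ * l) * σ = a * (θ * l * σ) := by ring
      _ ≤ a * ((ρ + φ) * (η * (μ - r))) := mul_le_mul_of_nonneg_left hprofit ha.le
      _ = (ρ + φ) * η * (a * (μ - r)) := by ring
      _ = -b * k * (ρ + φ) * η * σ := by rw [haP]; ring
  have hc : 0 ≤ 1 - (ρ + φ) ^ 2 := by nlinarith
  have hsq : 0 ≤ -b / 2 * ((y * σ + (ρ + φ) * (x * η) - k) ^ 2
      + (x * η) ^ 2 * (1 - (ρ + φ) ^ 2)) :=
    mul_nonneg (by linarith) (by positivity)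
  change f x y φ ≤ v
  rw [hv]
  simp only [f]
  linear_combination x * hins + y * haP + hsq
end

section
/- Assume a > 0, b < 0, l, η, σ > 0, μ > r, θ > 0, m, r, ρ ∈ ℝ, φ > 0 with |ρ + φ| < 1 and |ρ − φ| < 1, set ψ := θlσ/(η(μ−r)), and suppose φ < ψ − ρ and φ < ψ⁻¹ − ρ. Then the supremum over x ≥ 0 and y ∈ ℝ of the infimum over ξ ∈ [−φ, φ] of f(x, y, ξ) equals a·m·r − (a²/b)·p₊, where p₊ := (θ²l²σ² − 2(ρ+φ)θl(μ−r)ησ + (μ−r)²η²)/(2(1−(ρ+φ)²)η²σ²). It is attained at x* = −(a/b)·(θlσ − (ρ+φ)(μ−r)η)/((1−(ρ+φ)²)η²σ) and y* = −(a/b)·((μ−r)η − (ρ+φ)θlσ)/((1−(ρ+φ)²)ησ²), both of which are strictly positive, and the inner infimum at (x*, y*) is attained at ξ* = φ. -/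
/-- Completing the square: a two-asset mean-variance objective with excess returns `A`, `B`
equals its value at the critical point plus a quadratic form in the deviation from it. -/
theorem meanVariance_completeSquare {b k η σ : ℝ} (a A B c x y : ℝ) (hb : b ≠ 0)
    (hk : 1 - k ^ 2 ≠ 0) (hη : η ≠ 0) (hσ : σ ≠ 0) :
    a * (x * A + y * B + c)
        + b / 2 * (x ^ 2 * η ^ 2 + 2 * k * x * η * y * σ + y ^ 2 * σ ^ 2)
      = a * c - a ^ 2 / b * ((A ^ 2 * σ ^ 2 - 2 * k * A * B * η * σ + B ^ 2 * η ^ 2)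
          / (2 * (1 - k ^ 2) * η ^ 2 * σ ^ 2))
        + b / 2 *
          (((x - -(a / b) * (A * σ - k * B * η) / ((1 - k ^ 2) * η ^ 2 * σ)) * η
              + k * ((y - -(a / b) * (B * η - k * A * σ) / ((1 - k ^ 2) * η * σ ^ 2)) * σ)) ^ 2
            + (1 - k ^ 2)
              * ((y - -(a / b) * (B * η - k * A * σ) / ((1 - k ^ 2) * η * σ ^ 2)) * σ) ^ 2) := by
  field_simp
  ring


/-- Upper-bound correlation-distorted regime of the robust HJBI Hamiltonian:
if `φ < ψ - ρ` and `φ < ψ⁻¹ - ρ`, the sup-inf of the Hamiltonian integrand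
equals `a m r - (a²/b) p₊`, attained at strictly positive `x*, y*`, with the
inner infimum attained at `ξ* = φ`. -/
theorem stmt_2 (a b l η σ μ r θ m ρ φ : ℝ)
    (ha : 0 < a) (hb : b < 0)
    (hl : 0 < l) (hη : 0 < η) (hσ : 0 < σ) (hμr : r < μ) (hθ : 0 < θ) (hφ : 0 < φ)
    (hup : |ρ + φ| < 1) (hlo : |ρ - φ| < 1)
    (hcase1 : φ < θ * l * σ / (η * (μ - r)) - ρ)
    (hcase2 : φ < (θ * l * σ / (η * (μ - r)))⁻¹ - ρ) :
    let f : ℝ → ℝ → ℝ → ℝ := fun x y ξ =>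
      a * (x * θ * l + y * (μ - r) + m * r)
        + b / 2 * (x ^ 2 * η ^ 2 + 2 * (ρ + ξ) * x * η * y * σ + y ^ 2 * σ ^ 2)
    let p := (θ ^ 2 * l ^ 2 * σ ^ 2 - 2 * (ρ + φ) * θ * l * (μ - r) * η * σ
        + (μ - r) ^ 2 * η ^ 2) / (2 * (1 - (ρ + φ) ^ 2) * η ^ 2 * σ ^ 2)
    let v := a * m * r - a ^ 2 / b * p
    let xs := -(a / b) * (θ * l * σ - (ρ + φ) * (μ - r) * η)
        / ((1 - (ρ + φ) ^ 2) * η ^ 2 * σ)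
    let ys := -(a / b) * ((μ - r) * η - (ρ + φ) * θ * l * σ)
        / ((1 - (ρ + φ) ^ 2) * η * σ ^ 2)
    0 < xs ∧ 0 < ys ∧
    f xs ys φ = v ∧
    (∀ ξ ∈ Set.Icc (-φ) φ, f xs ys φ ≤ f xs ys ξ) ∧
    (∀ x, 0 ≤ x → ∀ y : ℝ, sInf ((fun ξ => f x y ξ) '' Set.Icc (-φ) φ) ≤ v) := by
  intro f p v xs ys
  have hB : 0 < μ - r := sub_pos.2 hμr
  have hk : 0 < 1 - (ρ + φ) ^ 2 := sub_pos.2 ((sq_lt_one_iff_abs_lt_one _).2 hup)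
  have hab : 0 < -(a / b) := neg_pos.2 (div_neg_of_pos_of_neg ha hb)
  have h₁ : (ρ + φ) * (μ - r) * η < θ * l * σ := by
    have h : ρ + φ < θ * l * σ / (η * (μ - r)) := by linarith
    rw [lt_div_iff₀ (by positivity)] at h
    linarith
  have h₂ : (ρ + φ) * θ * l * σ < (μ - r) * η := by
    have h : ρ + φ < (θ * l * σ / (η * (μ - r)))⁻¹ := by linarith
    rw [inv_div, lt_div_iff₀ (by positivity)] at h
    linarith
  have hx : 0 < xs := div_pos (mul_pos hab (sub_pos.2 h₁)) (by positivity)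
  have hy : 0 < ys := div_pos (mul_pos hab (sub_pos.2 h₂)) (by positivity)
  have square (x y : ℝ) : f x y φ = v + b / 2 *
      (((x - xs) * η + (ρ + φ) * ((y - ys) * σ)) ^ 2
        + (1 - (ρ + φ) ^ 2) * ((y - ys) * σ) ^ 2) := by
    have h := meanVariance_completeSquare a (θ * l) (μ - r) (m * r) x y hb.ne hk.ne'
      hη.ne' hσ.ne'
    simp only [f, v, p, xs, ys]
    simpa only [mul_pow, ← mul_assoc] using h
  refine ⟨hx, hy, by rw [square]; ring, fun ξ hξ => ?_, fun x _ y => ?_⟩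
  · have h : 0 ≤ -b * (φ - ξ) * (xs * η * ys * σ) :=
      mul_nonneg (mul_nonneg (neg_pos.2 hb).le (sub_nonneg.2 hξ.2)) (by positivity)
    simp only [f]
    linarith
  · have hcont : Continuous (fun ξ => f x y ξ) := by fun_prop
    refine (csInf_le (isCompact_Icc.image hcont).bddBelow
      ⟨φ, Set.right_mem_Icc.2 (by linarith), rfl⟩).trans ?_
    change f x y φ ≤ v
    rw [square]
    have h := mul_nonpos_of_nonpos_of_nonneg (by linarith : b / 2 ≤ 0)
      (by positivity : 0 ≤ ((x - xs) * η + (ρ + φ) * ((y - ys) * σ)) ^ 2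
        + (1 - (ρ + φ) ^ 2) * ((y - ys) * σ) ^ 2)
    linarith
end

section
/- Assume a > 0, b < 0, l, η, σ > 0, μ > r, θ > 0, m, r, ρ ∈ ℝ, φ > 0 with |ρ + φ| < 1 and |ρ − φ| < 1, set ψ := θlσ/(η(μ−r)), and suppose ρ − ψ < φ < ρ − ψ⁻¹. Then the supremum over x ≥ 0 and y ∈ ℝ of the infimum over ξ ∈ [−φ, φ] of f(x, y, ξ) equals a·m·r − (a²/b)·p₋, where p₋ := (θ²l²σ² − 2(ρ−φ)θl(μ−r)ησ + (μ−r)²η²)/(2(1−(ρ−φ)²)η²σ²). It is attained at x* = −(a/b)·(θlσ − (ρ−φ)(μ−r)η)/((1−(ρ−φ)²)η²σ), which is strictly positive, and y* = −(a/b)·((μ−r)η − (ρ−φ)θlσ)/((1−(ρ−φ)²)ησ²), which is strictly negative, and the inner infimum at (x*, y*) is attained at ξ* = −φ. -/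
/-- Lower-bound correlation-distorted regime of the robust HJBI Hamiltonian:
if `ρ - ψ < φ < ρ - ψ⁻¹`, the sup-inf of the Hamiltonian integrand equals
`a m r - (a²/b) p₋`, attained at `x* > 0` and `y* < 0`, with the inner infimum
attained at `ξ* = -φ`. -/
theorem stmt_3 (a b l η σ μ r θ m ρ φ : ℝ)
    (ha : 0 < a) (hb : b < 0)
    (hl : 0 < l) (hη : 0 < η) (hσ : 0 < σ) (hμr : r < μ) (hθ : 0 < θ) (hφ : 0 < φ)
    (hup : |ρ + φ| < 1) (hlo : |ρ - φ| < 1)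
    (hcase1 : ρ - θ * l * σ / (η * (μ - r)) < φ)
    (hcase2 : φ < ρ - (θ * l * σ / (η * (μ - r)))⁻¹) :
    let f : ℝ → ℝ → ℝ → ℝ := fun x y ξ =>
      a * (x * θ * l + y * (μ - r) + m * r)
        + b / 2 * (x ^ 2 * η ^ 2 + 2 * (ρ + ξ) * x * η * y * σ + y ^ 2 * σ ^ 2)
    let p := (θ ^ 2 * l ^ 2 * σ ^ 2 - 2 * (ρ - φ) * θ * l * (μ - r) * η * σ
        + (μ - r) ^ 2 * η ^ 2) / (2 * (1 - (ρ - φ) ^ 2) * η ^ 2 * σ ^ 2)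
    let v := a * m * r - a ^ 2 / b * p
    let xs := -(a / b) * (θ * l * σ - (ρ - φ) * (μ - r) * η)
        / ((1 - (ρ - φ) ^ 2) * η ^ 2 * σ)
    let ys := -(a / b) * ((μ - r) * η - (ρ - φ) * θ * l * σ)
        / ((1 - (ρ - φ) ^ 2) * η * σ ^ 2)
    0 < xs ∧ ys < 0 ∧
    f xs ys (-φ) = v ∧
    (∀ ξ ∈ Set.Icc (-φ) φ, f xs ys (-φ) ≤ f xs ys ξ) ∧
    (∀ x, 0 ≤ x → ∀ y : ℝ, sInf ((fun ξ => f x y ξ) '' Set.Icc (-φ) φ) ≤ v) := by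
  intro f p v xs ys
  have hk : 0 < μ - r := sub_pos.2 hμr
  have hT : 0 < θ * l * σ := by positivity
  have hD : 0 < 1 - (ρ - φ) ^ 2 := sub_pos.2 ((sq_lt_one_iff_abs_lt_one _).2 hlo)
  have hab : 0 < -(a / b) := neg_pos.2 (div_neg_of_pos_of_neg ha hb)
  have hx_num : 0 < θ * l * σ - (ρ - φ) * (μ - r) * η := by
    have h : ρ - φ < θ * l * σ / (η * (μ - r)) := by linarith
    rw [lt_div_iff₀ (by positivity)] at h
    linarith
  have hy_num : (μ - r) * η - (ρ - φ) * θ * l * σ < 0 := by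
    have h : (θ * l * σ / (η * (μ - r)))⁻¹ < ρ - φ := by linarith
    rw [inv_div, div_lt_iff₀ hT] at h
    linarith
  have hxs : 0 < xs := div_pos (mul_pos hab hx_num) (by positivity)
  have hys : ys < 0 := div_neg_of_neg_of_pos (mul_neg_of_pos_of_neg hab hy_num) (by positivity)
  have hb0 : b ≠ 0 := hb.ne
  have hD0 := hD.ne'
  have hfoc_x : a * (θ * l) + b * (xs * η ^ 2 + (ρ - φ) * η * σ * ys) = 0 := by
    simp only [xs, ys]
    generalize ρ - φ = c at hD0 ⊢
    field_simp
    ring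
  have hfoc_y : a * (μ - r) + b * ((ρ - φ) * η * σ * xs + ys * σ ^ 2) = 0 := by
    simp only [xs, ys]
    generalize ρ - φ = c at hD0 ⊢
    field_simp
    ring
  have hlinear : a * m * r + a / 2 * (xs * (θ * l) + ys * (μ - r)) = v := by
    simp only [v, p, xs, ys]
    generalize ρ - φ = c at hD0 ⊢
    field_simp
    ring
  have hval : f xs ys (-φ) = v := by
    rw [← hlinear]
    simp only [f]
    linear_combination xs / 2 * hfoc_x + ys / 2 * hfoc_y
  refine ⟨hxs, hys, hval, fun ξ hξ => ?_, fun x _ y => ?_⟩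
  · have hdiff : f xs ys ξ - f xs ys (-φ) = (-b) * xs * η * (-ys) * σ * (ξ + φ) := by
      simp only [f]
      ring
    have hb' : 0 < -b := neg_pos.2 hb
    have hys' : 0 < -ys := neg_pos.2 hys
    have hξ' : 0 ≤ ξ + φ := by linarith [hξ.1]
    have : 0 ≤ (-b) * xs * η * (-ys) * σ * (ξ + φ) := by positivity
    linarith
  · have hbdd : BddBelow ((fun ξ => f x y ξ) '' Set.Icc (-φ) φ) := by
      refine (isCompact_Icc.image ?_).bddBelow
      simp only [f]
      fun_prop
    refine (csInf_le hbdd ⟨-φ, ⟨le_rfl, by linarith⟩, rfl⟩).trans ?_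
    rw [← hval]
    have hdiff : f x y (-φ) - f xs ys (-φ) =
        b / 2 * ((η * (x - xs) + (ρ - φ) * (σ * (y - ys))) ^ 2
          + (1 - (ρ - φ) ^ 2) * (σ * (y - ys)) ^ 2) := by
      simp only [f]
      linear_combination (x - xs) * hfoc_x + (y - ys) * hfoc_y
    have hneg : b / 2 * ((η * (x - xs) + (ρ - φ) * (σ * (y - ys))) ^ 2
          + (1 - (ρ - φ) ^ 2) * (σ * (y - ys)) ^ 2) ≤ 0 :=
      mul_nonpos_of_nonpos_of_nonneg (by linarith) (by positivity)
    change f x y (-φ) ≤ _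
    linarith
end

section
/- Assume a > 0, b < 0, l, η, σ > 0, μ > r, θ > 0, m, r, ρ ∈ ℝ, φ > 0 with |ρ + φ| < 1 and |ρ − φ| < 1, set ψ := θlσ/(η(μ−r)), and suppose φ ≥ ψ⁻¹ − ρ and φ ≥ ρ − ψ⁻¹. Then the supremum over x ≥ 0 and y ∈ ℝ of the infimum over ξ ∈ [−φ, φ] of f(x, y, ξ) equals a·m·r − (a²/(2b))·(θl/η)², and it is attained at x* = −(a/b)·θl/η² and y* = 0 (at which point f is independent of ξ; the distortion ξ* = ψ⁻¹ − ρ lies in [−φ, φ]). -/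
/-- Pure-underwriting regime of the robust HJBI Hamiltonian: if `φ ≥ ψ⁻¹ - ρ`
and `φ ≥ ρ - ψ⁻¹`, the sup-inf of the Hamiltonian integrand equals
`a m r - (a²/(2b)) (θl/η)²`, attained at `x* = -(a/b) θl/η²`, `y* = 0`, where
`f` is independent of `ξ` and the distortion `ξ* = ψ⁻¹ - ρ` lies in `[-φ, φ]`. -/
theorem stmt_4 (a b l η σ μ r θ m ρ φ : ℝ)
    (ha : 0 < a) (hb : b < 0)
    (hl : 0 < l) (hη : 0 < η) (hσ : 0 < σ) (hμr : r < μ) (hθ : 0 < θ) (hφ : 0 < φ)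
    (hup : |ρ + φ| < 1) (hlo : |ρ - φ| < 1)
    (hcase1 : φ ≥ (θ * l * σ / (η * (μ - r)))⁻¹ - ρ)
    (hcase2 : φ ≥ ρ - (θ * l * σ / (η * (μ - r)))⁻¹) :
    let f : ℝ → ℝ → ℝ → ℝ := fun x y ξ =>
      a * (x * θ * l + y * (μ - r) + m * r)
        + b / 2 * (x ^ 2 * η ^ 2 + 2 * (ρ + ξ) * x * η * y * σ + y ^ 2 * σ ^ 2)
    let v := a * m * r - a ^ 2 / (2 * b) * (θ * l / η) ^ 2
    let xs := -(a / b) * θ * l / η ^ 2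
    let ys : ℝ := 0
    (∀ ξ ∈ Set.Icc (-φ) φ, f xs ys ξ = v) ∧
    ((θ * l * σ / (η * (μ - r)))⁻¹ - ρ) ∈ Set.Icc (-φ) φ ∧
    (∀ x, 0 ≤ x → ∀ y : ℝ, sInf ((fun ξ => f x y ξ) '' Set.Icc (-φ) φ) ≤ v) := by
  intro f v xs ys
  have hb_ne : b ≠ 0 := hb.ne
  have hd : 0 < μ - r := sub_pos.mpr hμr
  set c := (θ * l * σ / (η * (μ - r)))⁻¹ with hc
  have hmem : c - ρ ∈ Set.Icc (-φ) φ := ⟨by linarith, by linarith⟩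
  refine ⟨fun ξ _ => ?_, hmem, fun x _ y => ?_⟩
  · simp only [f, v, xs, ys]
    field_simp
    ring
  · have hbdd : BddBelow ((fun ξ => f x y ξ) '' Set.Icc (-φ) φ) := by
      refine (isCompact_Icc.image ?_).bddBelow
      simp only [f]
      fun_prop
    refine (csInf_le hbdd ⟨c - ρ, hmem, rfl⟩).trans ?_
    have hc_sq : 0 ≤ 1 - c ^ 2 := by
      have h₁ := (abs_lt.mp hup).2
      have h₂ := (abs_lt.mp hlo).1
      nlinarith
    have hdrift : μ - r = θ * l / η * c * σ := by
      rw [hc]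
      field_simp
    have key : v - f x y (c - ρ) =
        -b / 2 * ((x * η + c * (y * σ) + a * (θ * l / η) / b) ^ 2
          + (1 - c ^ 2) * (y * σ) ^ 2) := by
      simp only [f, v]
      rw [hdrift]
      clear_value c
      field_simp
      ring
    have hnonneg : 0 ≤ v - f x y (c - ρ) := by
      rw [key]
      have : 0 ≤ -b / 2 := by linarith
      positivity
    linarith
end

section
/- Let l, η, σ, α, γ > 0, μ > r, E > 0, and define for c ∈ (−1, 1): Θ(c) := (γ(1−c²)η² + c((μ−r)/σ)ηE)/((l/α)γ(1−c²) + lE), A := ((μ−r)/(2ησ))·(E/γ), Q := ((μ−r)/(ησ))·(1/α + E/γ). Then for every c ∈ (−1, 1): (i) the market-clearing identity (Θ(c)·lσ − c(μ−r)η)·E/(γ(1−c²)η²σ) = 1 − l·Θ(c)/(αη²) holds, i.e., the insurer's optimal supply at price Θ(c) equals the policyholder's demand; (ii) Θ(c) ≥ 0 if and only if c ≥ A − √(A²+1); (iii) the equilibrium underwriting X(c) := (1 − c(μ−r)/(αησ))·E/(γ(1−c²)/α + E) is strictly positive if and only if c < αησ/(μ−r); (iv) the equilibrium investment Y(c) :=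 (1/α + E/γ − cησ/(μ−r))·((μ−r)/σ²)·E/(γ(1−c²)/α + E) is strictly positive if and only if c < Q. In particular, when c = ρ + φ satisfies A − √(A²+1) ≤ c < min{αησ/(μ−r), Q}, the price Θ(c) clears the market with nonnegative price, strictly positive underwriting and strictly positive investment (the upper-bound correlation-distorted equilibrium). -/
/-- For `A > 0`, the larger root of `1 + 2 * A * c - c ^ 2` is at least `1`, so for `c < 1`
the sign of this quadratic is decided by the smaller root. -/
theorem quadratic_nonneg_iff_sub_sqrt_le {A c : ℝ} (hA : 0 < A) (hc : c < 1) :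
    0 ≤ 1 - c ^ 2 + 2 * A * c ↔ A - Real.sqrt (A ^ 2 + 1) ≤ c := by
  have hroot : 1 ≤ Real.sqrt (A ^ 2 + 1) := Real.one_le_sqrt.2 (by nlinarith [sq_nonneg A])
  have hquad : 0 ≤ 1 - c ^ 2 + 2 * A * c ↔ (c - A) ^ 2 ≤ A ^ 2 + 1 := by
    constructor <;> intro h <;> linarith
  rw [hquad, Real.sq_le (by positivity)]
  constructor
  · rintro ⟨h, -⟩
    linarith
  · intro h
    constructor <;> linarith

/-- Upper-bound correlation-distorted equilibrium: market clearing, sign of the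
price, positivity of underwriting and of investment, as functions of the
effective correlation `c ∈ (-1, 1)`. -/
theorem stmt_6 (l η σ α γ μ r E : ℝ)
    (hl : 0 < l) (hη : 0 < η) (hσ : 0 < σ) (hα : 0 < α) (hγ : 0 < γ)
    (hμr : r < μ) (hE : 0 < E) :
    let Θ : ℝ → ℝ := fun c =>
      (γ * (1 - c ^ 2) * η ^ 2 + c * ((μ - r) / σ) * η * E)
        / (l / α * γ * (1 - c ^ 2) + l * E)
    let A := (μ - r) / (2 * η * σ) * (E / γ)
    let Q := (μ - r) / (η * σ) * (1 / α + E / γ)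
    let X : ℝ → ℝ := fun c =>
      (1 - c * (μ - r) / (α * η * σ)) * E / (γ * (1 - c ^ 2) / α + E)
    let Y : ℝ → ℝ := fun c =>
      (1 / α + E / γ - c * η * σ / (μ - r)) * ((μ - r) / σ ^ 2) * E
        / (γ * (1 - c ^ 2) / α + E)
    ∀ c ∈ Set.Ioo (-1 : ℝ) 1,
      ((Θ c * l * σ - c * (μ - r) * η) * E / (γ * (1 - c ^ 2) * η ^ 2 * σ)
          = 1 - l * Θ c / (α * η ^ 2)) ∧
      (0 ≤ Θ c ↔ A - Real.sqrt (A ^ 2 + 1) ≤ c) ∧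
      (0 < X c ↔ c < α * η * σ / (μ - r)) ∧
      (0 < Y c ↔ c < Q) ∧
      (A - Real.sqrt (A ^ 2 + 1) ≤ c ∧ c < min (α * η * σ / (μ - r)) Q →
        0 ≤ Θ c ∧ 0 < X c ∧ 0 < Y c) := by
  intro Θ A Q X Y c hc
  have hm : 0 < μ - r := sub_pos.2 hμr
  have hw : 0 < 1 - c ^ 2 := by nlinarith [hc.1, hc.2]
  have hK : 0 < γ * (1 - c ^ 2) / α + E := by positivity
  have hA : 0 < A := by positivity
  have price_nonneg : 0 ≤ Θ c ↔ A - Real.sqrt (A ^ 2 + 1) ≤ c := by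
    rw [← quadratic_nonneg_iff_sub_sqrt_le hA hc.2]
    have hΘ : Θ c = γ * η ^ 2 / (l * (γ * (1 - c ^ 2) / α + E)) *
        (1 - c ^ 2 + 2 * A * c) := by
      have hD : l / α * γ * (1 - c ^ 2) + l * E = l * (γ * (1 - c ^ 2) / α + E) := by ring
      have hN : γ * (1 - c ^ 2) * η ^ 2 + c * ((μ - r) / σ) * η * E =
          γ * η ^ 2 * (1 - c ^ 2 + 2 * A * c) := by
        simp only [A]
        field_simp
      simp only [Θ]
      rw [hD, hN]
      ring
    rw [hΘ, mul_nonneg_iff_of_pos_left (by positivity)]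
  have underwriting_pos : 0 < X c ↔ c < α * η * σ / (μ - r) := by
    simp only [X]
    rw [div_pos_iff_of_pos_right hK, mul_pos_iff_of_pos_right hE, sub_pos,
      div_lt_one (by positivity), lt_div_iff₀ hm]
  have investment_pos : 0 < Y c ↔ c < Q := by
    have hQ : 1 / α + E / γ - c * η * σ / (μ - r) = η * σ / (μ - r) * (Q - c) := by
      simp only [Q]
      field_simp
    simp only [Y]
    rw [div_pos_iff_of_pos_right hK, mul_pos_iff_of_pos_right hE,
      mul_pos_iff_of_pos_right (by positivity), hQ,
      mul_pos_iff_of_pos_left (by positivity), sub_pos]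
  refine ⟨?_, price_nonneg, underwriting_pos, investment_pos, fun h => ?_⟩
  · have hK' : γ * (1 - c ^ 2) + α * E ≠ 0 := by positivity
    simp only [Θ]
    generalize 1 - c ^ 2 = w at *
    have hD : l / α * γ * w + l * E = l * (γ * w + α * E) / α := by field_simp
    rw [hD]
    field_simp
    ring
  · exact ⟨price_nonneg.2 h.1, underwriting_pos.2 (lt_min_iff.1 h.2).1,
      investment_pos.2 (lt_min_iff.1 h.2).2⟩
end

section
/- Let l, η, σ, α, γ > 0, μ > r, E > 0, set Q := ((μ−r)/(ησ))·(1/α + E/γ), and let c ∈ ℝ satisfy Q < c < αησ/(μ−r) and c < 1 (the lower-bound correlation-distorted regime with c = ρ − φ). Define Θ(c) := (γ(1−c²)η² + c((μ−r)/σ)ηE)/((l/α)γ(1−c²) + lE), X(c) := (1 − c(μ−r)/(αησ))·E/(γ(1−c²)/α + E) and Y(c) := (1/α + E/γ − cησ/(μ−r))·((μ−r)/σ²)·E/(γ(1−c²)/α + E). Then: (i) the market-clearing identity (Θ(c)·lσ − c(μ−r)η)·E/(γ(1−c²)η²σ) = 1 − l·Θ(c)/(αη²) holds; (ii) 0 <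 Θ(c) < αη²/l, so the equilibrium price is admissible; (iii) X(c) > 0; (iv) Y(c) < 0, i.e., the insurer holds a short position in the risky asset. -/
/-- Lower-bound correlation-distorted equilibrium: under `Q < c < αησ/(μ-r)`
and `c < 1`, the price clears the market, is admissible, underwriting is
strictly positive, and the investment position is strictly negative. -/
theorem stmt_7 (l η σ α γ μ r E c : ℝ)
    (hl : 0 < l) (hη : 0 < η) (hσ : 0 < σ) (hα : 0 < α) (hγ : 0 < γ)
    (hμr : r < μ) (hE : 0 < E)
    (hc1 : (μ - r) / (η * σ) * (1 / α + E / γ) < c)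
    (hc2 : c < α * η * σ / (μ - r))
    (hc3 : c < 1) :
    let Θ := (γ * (1 - c ^ 2) * η ^ 2 + c * ((μ - r) / σ) * η * E)
        / (l / α * γ * (1 - c ^ 2) + l * E)
    let X := (1 - c * (μ - r) / (α * η * σ)) * E / (γ * (1 - c ^ 2) / α + E)
    let Y := (1 / α + E / γ - c * η * σ / (μ - r)) * ((μ - r) / σ ^ 2) * E
        / (γ * (1 - c ^ 2) / α + E)
    ((Θ * l * σ - c * (μ - r) * η) * E / (γ * (1 - c ^ 2) * η ^ 2 * σ)
        = 1 - l * Θ / (α * η ^ 2)) ∧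
    (0 < Θ ∧ Θ < α * η ^ 2 / l) ∧
    0 < X ∧
    Y < 0 := by
  intro Θ X Y
  have hm : 0 < μ - r := sub_pos.mpr hμr
  have hc0 : 0 < c := lt_trans (by positivity) hc1
  have hsq : 0 < 1 - c ^ 2 := by nlinarith
  have hcm : c * (μ - r) < α * η * σ := (lt_div_iff₀ hm).mp hc2
  have hD : 0 < γ * (1 - c ^ 2) / α + E := by positivity
  have hL : 0 < l / α * γ * (1 - c ^ 2) + l * E := by positivity
  have hΘ : Θ * (l / α * γ * (1 - c ^ 2) + l * E)
      = γ * (1 - c ^ 2) * η ^ 2 + c * ((μ - r) / σ) * η * E :=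
    div_mul_cancel₀ _ hL.ne'
  refine ⟨?_, ⟨by positivity, ?_⟩, ?_, ?_⟩
  · clear_value Θ
    field_simp at hΘ ⊢
    linear_combination hΘ
  · have hcs : c * ((μ - r) / σ) < α * η := by
      rw [← mul_div_assoc, div_lt_iff₀ hσ]
      exact hcm
    have hR : α * η ^ 2 / l * (l / α * γ * (1 - c ^ 2) + l * E)
        = γ * (1 - c ^ 2) * η ^ 2 + α * η * η * E := by
      field_simp
    rw [div_lt_iff₀ hL, hR]
    gcongr
  · have h : 0 < 1 - c * (μ - r) / (α * η * σ) := by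
      rw [sub_pos, div_lt_one (by positivity)]
      exact hcm
    positivity
  · have h : 1 / α + E / γ - c * η * σ / (μ - r) < 0 := by
      rw [sub_neg, lt_div_iff₀ hm]
      rw [div_mul_eq_mul_div, div_lt_iff₀ (by positivity)] at hc1
      linarith
    exact div_neg_of_neg_of_pos
      (mul_neg_of_neg_of_pos (mul_neg_of_neg_of_pos h (by positivity)) hE) hD
end

section
/- Let l, η, σ, α, γ > 0, μ > r, E > 0, and define the pure underwriting price θᵖ := η²/((1/α + E/γ)·l) and Q := ((μ−r)/(ησ))·(1/α + E/γ). Then: (i) the market-clearing identity θᵖ·l·E/(γη²) = 1 − l·θᵖ/(αη²) holds, with common value (E/γ)/(1/α + E/γ) ∈ (0, 1); (ii) 0 < θᵖ < αη²/l, so the price is admissible; (iii) η(μ−r)/(θᵖ·lσ) = Q, so the condition ρ − φ ≤ Q ≤ ρ + φ is equivalent to the optimal correlation distortion ξ* = η(μ−r)/(θᵖlσ) − ρ satisfying (ξ*)² ≤ φ², i.e., lying in the ambiguity set. -/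
/-- Pure underwriting equilibrium: the price `θᵖ = η²/((1/α + E/γ)l)` clears the
market with common value `(E/γ)/(1/α + E/γ) ∈ (0,1)`, is admissible, and the
condition `ρ - φ ≤ Q ≤ ρ + φ` is equivalent to the optimal distortion
`ξ* = η(μ-r)/(θᵖ l σ) - ρ` lying in the ambiguity set. -/
theorem stmt_8 (l η σ α γ μ r E ρ φ : ℝ)
    (hl : 0 < l) (hη : 0 < η) (hσ : 0 < σ) (hα : 0 < α) (hγ : 0 < γ)
    (hμr : r < μ) (hE : 0 < E) (hφ : 0 ≤ φ) :
    let θp := η ^ 2 / ((1 / α + E / γ) * l)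
    let Q := (μ - r) / (η * σ) * (1 / α + E / γ)
    (θp * l * E / (γ * η ^ 2) = 1 - l * θp / (α * η ^ 2) ∧
      θp * l * E / (γ * η ^ 2) = (E / γ) / (1 / α + E / γ) ∧
      0 < (E / γ) / (1 / α + E / γ) ∧ (E / γ) / (1 / α + E / γ) < 1) ∧
    (0 < θp ∧ θp < α * η ^ 2 / l) ∧
    (η * (μ - r) / (θp * l * σ) = Q ∧
      ((ρ - φ ≤ Q ∧ Q ≤ ρ + φ) ↔
        (η * (μ - r) / (θp * l * σ) - ρ) ^ 2 ≤ φ ^ 2)) := by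
  intro θp Q
  have hA : 0 < 1 / α := by positivity
  have hG : 0 < E / γ := by positivity
  have hS : 0 < 1 / α + E / γ := by positivity
  have hθ : θp * l = η ^ 2 / (1 / α + E / γ) := by
    simp only [θp]
    field_simp
  have hsupply : θp * l * E / (γ * η ^ 2) = (E / γ) / (1 / α + E / γ) := by
    rw [hθ]
    generalize 1 / α + E / γ = S at hS
    field_simp
  have hdemand : 1 - l * θp / (α * η ^ 2) = (E / γ) / (1 / α + E / γ) := by
    have h : l * θp / (α * η ^ 2) = (1 / α) / (1 / α + E / γ) := by
      rw [mul_comm l, hθ]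
      generalize 1 / α + E / γ = S at hS
      field_simp
    rw [h, eq_div_iff hS.ne', sub_mul, div_mul_cancel₀ _ hS.ne']
    ring
  have hQ : η * (μ - r) / (θp * l * σ) = Q := by
    rw [hθ]
    simp only [Q]
    generalize 1 / α + E / γ = S at hS
    field_simp
  have hprice : θp < α * η ^ 2 / l := by
    rw [lt_div_iff₀ hl, hθ, div_lt_iff₀ hS]
    have h : α * η ^ 2 * (1 / α + E / γ) = η ^ 2 + α * η ^ 2 * (E / γ) := by
      field_simp
    have : 0 < α * η ^ 2 * (E / γ) := by positivity
    linarith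
  refine ⟨⟨hsupply.trans hdemand.symm, hsupply, by positivity, ?_⟩,
    ⟨by positivity, hprice⟩, hQ, ?_⟩
  · rw [div_lt_one hS]
    linarith
  · rw [hQ, sq_le_sq, abs_of_nonneg hφ, abs_le]
    constructor <;> rintro ⟨h₁, h₂⟩ <;> constructor <;> linarith
end

section
/- Let l, η, σ, α, γ > 0, μ > r, E > 0, ρ ∈ ℝ, φ ≥ 0 with |ρ + φ| < 1 and |ρ − φ| < 1, and set A := ((μ−r)/(2ησ))·(E/γ), Q := ((μ−r)/(ησ))·(1/α + E/γ), c := ρ + φ. Suppose the market-failure condition holds: c < A − √(A²+1), c < αησ/(μ−r), and c < Q. Then: (i) the upper-bound candidate price Θ(c) := (γ(1−c²)η² + c((μ−r)/σ)ηE)/((l/α)γ(1−c²) + lE) is strictly negative, hence inadmissible; (ii) the zero-underwriting condition ρ + φ ≥ αησ/(μ−r) fails; (iii) the lower-bound condition Q < ρ − φ fails; (iv) the pure underwriting condition ρ − φ ≤ Q ≤ ρ + φ fails. Hence no regime admits an admissible equilibrium price. -/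
/-- A number below the smaller root of `x ^ 2 - 2 * A * x - 1` makes this quadratic positive. -/
theorem one_sub_sq_add_two_mul_neg_of_lt_sub_sqrt {A c : ℝ}
    (h : c < A - Real.sqrt (A ^ 2 + 1)) : 1 - c ^ 2 + 2 * A * c < 0 := by
  have hsq : A ^ 2 + 1 < (A - c) ^ 2 :=
    Real.lt_sq_of_sqrt_lt (by linarith)
  linarith [sub_sq A c]


/-- Market failure: under the market-failure condition, the upper-bound
candidate price is strictly negative (hence inadmissible) and none of the
other regime conditions hold, so no regime admits an admissible price. -/
theorem stmt_9 (l η σ α γ μ r E ρ φ : ℝ)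
    (hl : 0 < l) (hη : 0 < η) (hσ : 0 < σ) (hα : 0 < α) (hγ : 0 < γ)
    (hμr : r < μ) (hE : 0 < E) (hφ : 0 ≤ φ)
    (hup : |ρ + φ| < 1) (hlo : |ρ - φ| < 1) :
    let A := (μ - r) / (2 * η * σ) * (E / γ)
    let Q := (μ - r) / (η * σ) * (1 / α + E / γ)
    let c := ρ + φ
    c < A - Real.sqrt (A ^ 2 + 1) →
    c < α * η * σ / (μ - r) →
    c < Q →
    ((γ * (1 - c ^ 2) * η ^ 2 + c * ((μ - r) / σ) * η * E)
        / (l / α * γ * (1 - c ^ 2) + l * E) < 0) ∧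
    ¬(ρ + φ ≥ α * η * σ / (μ - r)) ∧
    ¬(Q < ρ - φ) ∧
    ¬(ρ - φ ≤ Q ∧ Q ≤ ρ + φ) := by
  intro A Q c hcA hcα hcQ
  have hρφ : ρ - φ ≤ c := by
    change ρ - φ ≤ ρ + φ
    linarith
  refine ⟨div_neg_of_neg_of_pos ?_ ?_, not_le.mpr hcα, fun h => by linarith,
    fun h => absurd hcQ (not_lt.mpr h.2)⟩
  · have hnum : γ * (1 - c ^ 2) * η ^ 2 + c * ((μ - r) / σ) * η * E
        = γ * η ^ 2 * (1 - c ^ 2 + 2 * A * c) := by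
      simp only [A]
      field_simp
    rw [hnum]
    exact mul_neg_of_pos_of_neg (by positivity)
      (one_sub_sq_add_two_mul_neg_of_lt_sub_sqrt hcA)
  · have hc : 0 < 1 - c ^ 2 := sub_pos.mpr ((sq_lt_one_iff_abs_lt_one c).mpr hup)
    positivity
end

section
/- Let l, η, σ, α, γ > 0, μ > r, E > 0, and define on (−1, 1) the functions Θ(c) := (γ(1−c²)η² + c((μ−r)/σ)ηE)/((l/α)γ(1−c²) + lE), X(c) := (1 − c(μ−r)/(αησ))·E/(γ(1−c²)/α + E), and Y(c) := (1/α + E/γ − cησ/(μ−r))·((μ−r)/σ²)·E/(γ(1−c²)/α + E). Then for every c ∈ (−1, 0]: the derivative of Θ at c is strictly positive, the derivative of X at c is strictly negative, and the derivative of Y at c is strictly negative. That is, when the worst-case effective correlation ρ + φ is nonpositive, an increase in the reference correlation or in the ambiguity radius raises the equilibrium insurance price and lowers both the underwriting and investment positions. -/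
/-- The derivative of a quotient of quadratics whose denominator `G * (1 - c ^ 2) + F` is nonzero. -/
theorem hasDerivAt_quadratic_div (P B C G F c : ℝ) (hD : G * (1 - c ^ 2) + F ≠ 0) :
    HasDerivAt (fun x : ℝ => (P * (1 - x ^ 2) + B * x + C) / (G * (1 - x ^ 2) + F))
      ((B * (G * (1 - c ^ 2) + F) - 2 * c * P * F + 2 * G * c * (B * c + C))
        / (G * (1 - c ^ 2) + F) ^ 2) c := by
  have hq : HasDerivAt (fun x : ℝ => 1 - x ^ 2) (-(2 * c)) c := by
    simpa using (hasDerivAt_pow 2 c).const_sub 1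
  have hN := ((hq.const_mul P).add ((hasDerivAt_id c).const_mul B)).add_const C
  refine (hN.div ((hq.const_mul G).add_const F) hD).congr_deriv ?_
  simp only [Pi.add_apply, id]
  ring

/-- A positive affine function with negative slope, divided by `G * (1 - c ^ 2) + F`, has
negative derivative at nonpositive `c`. -/
theorem deriv_affine_div_neg {B C G F c : ℝ} (hB : B < 0) (hC : 0 < C) (hG : 0 < G)
    (hD : 0 < G * (1 - c ^ 2) + F) (hc : c ≤ 0) :
    deriv (fun x : ℝ => (B * x + C) / (G * (1 - x ^ 2) + F)) c < 0 := by
  have h := hasDerivAt_quadratic_div 0 B C G F c hD.ne'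
  simp only [zero_mul, zero_add, mul_zero, sub_zero] at h
  rw [h.deriv]
  have h1 := mul_neg_of_neg_of_pos hB hD
  have h2 : 0 ≤ B * c := mul_nonneg_of_nonpos_of_nonpos hB.le hc
  have h3 : 2 * G * c * (B * c + C) ≤ 0 :=
    mul_nonpos_of_nonpos_of_nonneg (mul_nonpos_of_nonneg_of_nonpos (by positivity) hc)
      (by positivity)
  exact div_neg_of_neg_of_pos (by linarith) (by positivity)

/-- In the upper-bound correlation-distorted equilibrium with nonpositive
effective correlation `c ∈ (-1, 0]`, the price is strictly increasing in `c`,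
while underwriting and investment are strictly decreasing in `c`. -/
theorem stmt_14 (l η σ α γ μ r E : ℝ)
    (hl : 0 < l) (hη : 0 < η) (hσ : 0 < σ) (hα : 0 < α) (hγ : 0 < γ)
    (hμr : r < μ) (hE : 0 < E) :
    let Θ : ℝ → ℝ := fun c =>
      (γ * (1 - c ^ 2) * η ^ 2 + c * ((μ - r) / σ) * η * E)
        / (l / α * γ * (1 - c ^ 2) + l * E)
    let X : ℝ → ℝ := fun c =>
      (1 - c * (μ - r) / (α * η * σ)) * E / (γ * (1 - c ^ 2) / α + E)
    let Y : ℝ → ℝ := fun c =>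
      (1 / α + E / γ - c * η * σ / (μ - r)) * ((μ - r) / σ ^ 2) * E
        / (γ * (1 - c ^ 2) / α + E)
    ∀ c ∈ Set.Ioc (-1 : ℝ) 0,
      0 < deriv Θ c ∧ deriv X c < 0 ∧ deriv Y c < 0 := by
  intro Θ X Y c ⟨hc1, hc0⟩
  have hm : 0 < μ - r := sub_pos.mpr hμr
  have hq : 0 < 1 - c ^ 2 := by nlinarith
  have hΘ : Θ = fun x => (γ * η ^ 2 * (1 - x ^ 2) + (μ - r) / σ * η * E * x + 0)
      / (l / α * γ * (1 - x ^ 2) + l * E) := by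
    funext x
    simp only [Θ]
    congr 1
    ring
  have hX : X = fun x => (-((μ - r) / (α * η * σ) * E) * x + E)
      / (γ / α * (1 - x ^ 2) + E) := by
    funext x
    simp only [X]
    congr 1 <;> ring
  have hY : Y = fun x => (-(η * σ / (μ - r) * ((μ - r) / σ ^ 2) * E) * x
      + (1 / α + E / γ) * ((μ - r) / σ ^ 2) * E) / (γ / α * (1 - x ^ 2) + E) := by
    funext x
    simp only [Y]
    congr 1 <;> ring
  refine ⟨?_, ?_, ?_⟩
  · have hD : 0 < l / α * γ * (1 - c ^ 2) + l * E := by positivity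
    rw [hΘ, (hasDerivAt_quadratic_div _ _ _ _ _ c hD.ne').deriv]
    refine div_pos ?_ (by positivity)
    have h1 : 0 < (μ - r) / σ * η * E * (l / α * γ * (1 - c ^ 2) + l * E) := by positivity
    have h2 : 0 ≤ -c * (2 * (γ * η ^ 2) * (l * E)) :=
      mul_nonneg (neg_nonneg.mpr hc0) (by positivity)
    have h3 : 0 ≤ 2 * (l / α * γ) * ((μ - r) / σ * η * E) * c ^ 2 := by positivity
    linarith
  · rw [hX]
    exact deriv_affine_div_neg (neg_neg_of_pos (by positivity)) hE (by positivity)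
      (by positivity) hc0
  · rw [hY]
    exact deriv_affine_div_neg (neg_neg_of_pos (by positivity)) (by positivity) (by positivity)
      (by positivity) hc0
end

section
/- Let l, η, σ, α, γ > 0, μ > r, E > 0, and set Q := ((μ−r)/(ησ))·(1/α + E/γ) and k := (μ−r)/(αησ). Define on (−1, 1) the functions Θ(c) := (γ(1−c²)η² + c((μ−r)/σ)ηE)/((l/α)γ(1−c²) + lE) and X(c) := (1 − ck)·E/(γ(1−c²)/α + E). Then for every c ∈ (−1, 1): the derivative of Θ at c is strictly positive (respectively zero, strictly negative) if and only if c·(1 − kc) < Q − c (respectively =, >); and the derivative of X at c is strictly negative (respectively zero, strictly positive) if and only if c·(1 − kc) < Q − c (respectively =, >). In particular, within the upper-bound correlation-distorted regime with c = ρ + φ > 0, the effect of greater ambiguity aversion on the equilibrium price and underwriting depends on whether c lies below or above the threshold determined by c(1 − kc) = Q − c. -/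
/-- In the upper-bound correlation-distorted equilibrium, the signs of the
derivatives of the price and of underwriting with respect to the effective
correlation `c ∈ (-1, 1)` are determined by the threshold condition
`c(1 - kc) ⋛ Q - c`. -/
theorem stmt_15 (l η σ α γ μ r E : ℝ)
    (hl : 0 < l) (hη : 0 < η) (hσ : 0 < σ) (hα : 0 < α) (hγ : 0 < γ)
    (hμr : r < μ) (hE : 0 < E) :
    let Q := (μ - r) / (η * σ) * (1 / α + E / γ)
    let k := (μ - r) / (α * η * σ)
    let Θ : ℝ → ℝ := fun c =>
      (γ * (1 - c ^ 2) * η ^ 2 + c * ((μ - r) / σ) * η * E)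
        / (l / α * γ * (1 - c ^ 2) + l * E)
    let X : ℝ → ℝ := fun c =>
      (1 - c * k) * E / (γ * (1 - c ^ 2) / α + E)
    ∀ c ∈ Set.Ioo (-1 : ℝ) 1,
      (0 < deriv Θ c ↔ c * (1 - k * c) < Q - c) ∧
      (deriv Θ c = 0 ↔ c * (1 - k * c) = Q - c) ∧
      (deriv Θ c < 0 ↔ Q - c < c * (1 - k * c)) ∧
      (deriv X c < 0 ↔ c * (1 - k * c) < Q - c) ∧
      (deriv X c = 0 ↔ c * (1 - k * c) = Q - c) ∧
      (0 < deriv X c ↔ Q - c < c * (1 - k * c)) := by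
  intro Q k Θ X c hc
  have hc2 : 0 < 1 - c ^ 2 := by nlinarith [hc.1, hc.2]
  have hD : 0 < γ * (1 - c ^ 2) / α + E := by positivity
  have hD' : 0 < l / α * γ * (1 - c ^ 2) + l * E := by positivity
  have hsq : HasDerivAt (fun x : ℝ => 1 - x ^ 2) (-(2 * c)) c := by
    simpa using (hasDerivAt_pow 2 c).const_sub 1
  have hQ : Q = k + k * E * α / γ := by
    simp only [Q, k]
    field_simp
  have hX : deriv X c
      = -(E * γ / α / (γ * (1 - c ^ 2) / α + E) ^ 2) * (Q - c - c * (1 - k * c)) := by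
    have h := ((((hasDerivAt_id' c).mul_const k).const_sub 1).mul_const E).fun_div
      (((hsq.const_mul γ).div_const α).add_const E) hD.ne'
    refine h.deriv.trans ?_
    rw [hQ]
    generalize k = k'
    field_simp
    ring
  have hΘ : deriv Θ c
      = α * η ^ 2 / l * (E * γ / α / (γ * (1 - c ^ 2) / α + E) ^ 2)
        * (Q - c - c * (1 - k * c)) := by
    have h := (((hsq.const_mul γ).mul_const (η ^ 2)).fun_add
      ((((hasDerivAt_id' c).mul_const ((μ - r) / σ)).mul_const η).mul_const E)).fun_div
      ((hsq.const_mul (l / α * γ)).add_const (l * E)) hD'.ne'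
    refine h.deriv.trans ?_
    have hden : l / α * γ * (1 - c ^ 2) + l * E = l * (γ * (1 - c ^ 2) / α + E) := by ring
    have hm : (μ - r) / σ = k * α * η := by
      simp only [k]
      field_simp
    rw [hden, hm, hQ]
    generalize k = k'
    field_simp
    ring
  have hA : 0 < E * γ / α / (γ * (1 - c ^ 2) / α + E) ^ 2 := by positivity
  have hB : 0 < α * η ^ 2 / l * (E * γ / α / (γ * (1 - c ^ 2) / α + E) ^ 2) := by positivity
  rw [hX, hΘ]
  refine ⟨?_, ?_, ?_, ?_, ?_, ?_⟩
  · rw [mul_pos_iff_of_pos_left hB, sub_pos]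
  · rw [mul_eq_zero_iff_left hB.ne', sub_eq_zero, eq_comm]
  · rw [← neg_pos, ← mul_neg, mul_pos_iff_of_pos_left hB, neg_sub, sub_pos]
  · rw [neg_mul, neg_lt_zero, mul_pos_iff_of_pos_left hA, sub_pos]
  · rw [neg_mul, neg_eq_zero, mul_eq_zero_iff_left hA.ne', sub_eq_zero, eq_comm]
  · rw [neg_mul, ← mul_neg, mul_pos_iff_of_pos_left hA, neg_sub, sub_pos]
end

section
/- Let l, η, σ, α, γ > 0, μ > r, E > 0, and set Q := ((μ−r)/(ησ))·(1/α + E/γ). Define on (−1, 1) the functions Θ(c) := (γ(1−c²)η² + c((μ−r)/σ)ηE)/((l/α)γ(1−c²) + lE), X(c) := (1 − c(μ−r)/(αησ))·E/(γ(1−c²)/α + E), and Y(c) := (1/α + E/γ − cησ/(μ−r))·((μ−r)/σ²)·E/(γ(1−c²)/α + E). Then for every c with Q < c < αησ/(μ−r) and c < 1 (the lower-bound correlation-distorted regime with c = ρ − φ): the derivative of Θ at c is strictly negative, the derivative of X at c is strictly positive, and the derivative of Y at c is strictly negative. Hence, in the lower-bound regime, a higher reference correlation or a lower ambiguity radius reduces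 the equilibrium insurance price, increases underwriting, and decreases the investment position. -/
/-- The quotient of two polynomials of degree at most two, the denominator being even. -/
theorem hasDerivAt_quadratic_div_s16 (a₀ a₁ a₂ p e c : ℝ) (h : p * (1 - c ^ 2) + e ≠ 0) :
    HasDerivAt (fun x : ℝ => (a₀ + a₁ * x + a₂ * x ^ 2) / (p * (1 - x ^ 2) + e))
      (((a₁ + 2 * a₂ * c) * (p * (1 - c ^ 2) + e)
        + 2 * p * c * (a₀ + a₁ * c + a₂ * c ^ 2)) / (p * (1 - c ^ 2) + e) ^ 2) c := by
  have hsq : HasDerivAt (fun x : ℝ => x ^ 2) (2 * c) c := by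
    simpa using hasDerivAt_pow 2 c
  have hnum : HasDerivAt (fun x : ℝ => a₀ + a₁ * x + a₂ * x ^ 2)
      (a₁ * 1 + a₂ * (2 * c)) c :=
    (((hasDerivAt_id' c).const_mul a₁).const_add a₀).add (hsq.const_mul a₂)
  have hden : HasDerivAt (fun x : ℝ => p * (1 - x ^ 2) + e) (p * -(2 * c)) c :=
    ((hsq.const_sub 1).const_mul p).add_const e
  refine (hnum.div hden h).congr_deriv ?_
  congr 1
  ring


/-- In the lower-bound correlation-distorted equilibrium
(`Q < c < αησ/(μ-r)`, `c < 1`), the price is strictly decreasing, underwriting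
strictly increasing, and the investment position strictly decreasing in the
effective correlation `c = ρ - φ`. -/
theorem stmt_16 (l η σ α γ μ r E : ℝ)
    (hl : 0 < l) (hη : 0 < η) (hσ : 0 < σ) (hα : 0 < α) (hγ : 0 < γ)
    (hμr : r < μ) (hE : 0 < E) :
    let Q := (μ - r) / (η * σ) * (1 / α + E / γ)
    let Θ : ℝ → ℝ := fun c =>
      (γ * (1 - c ^ 2) * η ^ 2 + c * ((μ - r) / σ) * η * E)
        / (l / α * γ * (1 - c ^ 2) + l * E)
    let X : ℝ → ℝ := fun c =>
      (1 - c * (μ - r) / (α * η * σ)) * E / (γ * (1 - c ^ 2) / α + E)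
    let Y : ℝ → ℝ := fun c =>
      (1 / α + E / γ - c * η * σ / (μ - r)) * ((μ - r) / σ ^ 2) * E
        / (γ * (1 - c ^ 2) / α + E)
    ∀ c : ℝ, Q < c → c < α * η * σ / (μ - r) → c < 1 →
      deriv Θ c < 0 ∧ 0 < deriv X c ∧ deriv Y c < 0 := by
  intro Q Θ X Y c hQ hc hc1
  have hm : 0 < μ - r := sub_pos.mpr hμr
  have hQpos : 0 < Q := by positivity
  have hc0 : 0 < c := hQpos.trans hQ
  have hc2 : 0 < 1 - c ^ 2 := by nlinarith
  have hD : 0 < γ / α * (1 - c ^ 2) + E := by positivity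
  have hD' : 0 < l / α * γ * (1 - c ^ 2) + l * E := by positivity
  have hbc : c * (μ - r) < α * η * σ := (lt_div_iff₀ hm).mp hc
  have hQc : (μ - r) * (γ + α * E) < c * (η * σ * α * γ) := by
    have h : Q * (η * σ * α * γ) = (μ - r) * (γ + α * E) := by
      simp only [Q]
      field_simp
    rw [← h]
    gcongr
  have key : 0 < 2 * α * γ * η * σ * c - (μ - r) * (γ + α * E) - γ * (μ - r) * c ^ 2 := by
    have := mul_lt_mul_of_pos_left hbc (mul_pos hγ hc0)
    nlinarith
  refine ⟨?_, ?_, ?_⟩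
  · have hΘ : Θ = fun x => (γ * η ^ 2 + (μ - r) / σ * η * E * x + -(γ * η ^ 2) * x ^ 2)
        / (l / α * γ * (1 - x ^ 2) + l * E) := by
      funext x
      simp only [Θ]
      ring
    rw [hΘ, (hasDerivAt_quadratic_div_s16 _ _ _ _ _ c hD'.ne').deriv]
    refine div_neg_of_neg_of_pos ?_ (by positivity)
    have h : ((μ - r) / σ * η * E + 2 * -(γ * η ^ 2) * c) * (l / α * γ * (1 - c ^ 2) + l * E)
        + 2 * (l / α * γ) * c
          * (γ * η ^ 2 + (μ - r) / σ * η * E * c + -(γ * η ^ 2) * c ^ 2)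
        = -(l * η * E / (α * σ)
          * (2 * α * γ * η * σ * c - (μ - r) * (γ + α * E) - γ * (μ - r) * c ^ 2)) := by
      field_simp
      ring
    rw [h]
    exact neg_neg_of_pos (by positivity)
  · have hX : X = fun x => (E + -((μ - r) * E / (α * η * σ)) * x + 0 * x ^ 2)
        / (γ / α * (1 - x ^ 2) + E) := by
      funext x
      simp only [X]
      ring
    rw [hX, (hasDerivAt_quadratic_div_s16 _ _ _ _ _ c hD.ne').deriv]
    refine div_pos ?_ (by positivity)
    have h : (-((μ - r) * E / (α * η * σ)) + 2 * 0 * c) * (γ / α * (1 - c ^ 2) + E)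
        + 2 * (γ / α) * c * (E + -((μ - r) * E / (α * η * σ)) * c + 0 * c ^ 2)
        = E / (α ^ 2 * η * σ)
          * (2 * α * γ * η * σ * c - (μ - r) * (γ + α * E) - γ * (μ - r) * c ^ 2) := by
      field_simp
      ring
    rw [h]
    positivity
  · have hY : Y = fun x => (η * E / σ * Q + -(η * E / σ) * x + 0 * x ^ 2)
        / (γ / α * (1 - x ^ 2) + E) := by
      funext x
      simp only [Y, Q]
      congr 1
      · field_simp
        ring
      · ring
    rw [hY, (hasDerivAt_quadratic_div_s16 _ _ _ _ _ c hD.ne').deriv]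
    refine div_neg_of_neg_of_pos ?_ (by positivity)
    have h : (-(η * E / σ) + 2 * 0 * c) * (γ / α * (1 - c ^ 2) + E)
        + 2 * (γ / α) * c * (η * E / σ * Q + -(η * E / σ) * c + 0 * c ^ 2)
        = -(η * E / σ * ((γ / α * (1 - c ^ 2) + E) + 2 * (γ / α) * c * (c - Q))) := by
      ring
    rw [h]
    have hcQ : 0 < c - Q := sub_pos.mpr hQ
    exact neg_neg_of_pos (by positivity)
end

section
/- Let l, η, σ, α, γ > 0, E > 0, and fix an effective correlation c ∈ (−1, 1). Viewing the upper-bound correlation-distorted equilibrium quantities as functions of the Sharpe ratio S > 0 (i.e., with μ − r = Sσ and σ fixed), define Θ̂(S) := (γ(1−c²)η² + cSηE)/((l/α)γ(1−c²) + lE), X̂(S) := (1 − cS/(αη))·E/(γ(1−c²)/α + E), and Ŷ(S) := ((1/α + E/γ)·S − cη)·(E/σ)/(γ(1−c²)/α + E). Then for every S > 0: the derivative of Θ̂ at S is strictly positive (respectively zero, strictly negative) if and only if c > 0 (respectively c = 0, c < 0); the derivative of X̂ at S is strictly negative (respectively zero, strictly positive) if and only if c > 0 (respectively c = 0, c < 0);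 and the derivative of Ŷ at S is strictly positive. -/
theorem deriv_linear_add_const (a b x : ℝ) : deriv (fun S : ℝ => a * S + b) x = a := by
  simp

/-- Comparative statics in the Sharpe ratio `S` within the upper-bound
correlation-distorted equilibrium at fixed effective correlation `c ∈ (-1,1)`:
the signs of the derivatives of price and underwriting are determined by the
sign of `c`, and the investment position is strictly increasing in `S`. -/
theorem stmt_17 (l η σ α γ E c : ℝ)
    (hl : 0 < l) (hη : 0 < η) (hσ : 0 < σ) (hα : 0 < α) (hγ : 0 < γ)
    (hE : 0 < E) (hc : c ∈ Set.Ioo (-1 : ℝ) 1) :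
    let Θ : ℝ → ℝ := fun S =>
      (γ * (1 - c ^ 2) * η ^ 2 + c * S * η * E)
        / (l / α * γ * (1 - c ^ 2) + l * E)
    let X : ℝ → ℝ := fun S =>
      (1 - c * S / (α * η)) * E / (γ * (1 - c ^ 2) / α + E)
    let Y : ℝ → ℝ := fun S =>
      ((1 / α + E / γ) * S - c * η) * (E / σ) / (γ * (1 - c ^ 2) / α + E)
    ∀ S : ℝ, 0 < S →
      (0 < deriv Θ S ↔ 0 < c) ∧
      (deriv Θ S = 0 ↔ c = 0) ∧
      (deriv Θ S < 0 ↔ c < 0) ∧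
      (deriv X S < 0 ↔ 0 < c) ∧
      (deriv X S = 0 ↔ c = 0) ∧
      (0 < deriv X S ↔ c < 0) ∧
      0 < deriv Y S := by
  intro Θ X Y S _
  have hc2 : 0 < 1 - c ^ 2 := by nlinarith [hc.1, hc.2]
  have hD : 0 < l / α * γ * (1 - c ^ 2) + l * E := by positivity
  have hF : 0 < γ * (1 - c ^ 2) / α + E := by positivity
  have hΘ : deriv Θ S = c * (η * E / (l / α * γ * (1 - c ^ 2) + l * E)) := by
    rw [← deriv_linear_add_const (c * (η * E / (l / α * γ * (1 - c ^ 2) + l * E)))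
      (γ * (1 - c ^ 2) * η ^ 2 / (l / α * γ * (1 - c ^ 2) + l * E)) S]
    congr 1
    funext x
    simp only [Θ]
    ring
  have hX : deriv X S = -(c * (E / (α * η) / (γ * (1 - c ^ 2) / α + E))) := by
    rw [← deriv_linear_add_const (-(c * (E / (α * η) / (γ * (1 - c ^ 2) / α + E))))
      (E / (γ * (1 - c ^ 2) / α + E)) S]
    congr 1
    funext x
    simp only [X]
    ring
  have hY : deriv Y S = (1 / α + E / γ) * (E / σ) / (γ * (1 - c ^ 2) / α + E) := by
    rw [← deriv_linear_add_const ((1 / α + E / γ) * (E / σ) / (γ * (1 - c ^ 2) / α + E))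
      (-(c * η * (E / σ) / (γ * (1 - c ^ 2) / α + E))) S]
    congr 1
    funext x
    simp only [Y]
    ring
  have hk : 0 < η * E / (l / α * γ * (1 - c ^ 2) + l * E) := by positivity
  have hm : 0 < E / (α * η) / (γ * (1 - c ^ 2) / α + E) := by positivity
  rw [hΘ, hX, hY, neg_lt_zero, neg_eq_zero, neg_pos]
  exact ⟨mul_pos_iff_of_pos_right hk, mul_eq_zero_iff_right hk.ne',
    by simp [mul_neg_iff, hk, hk.not_gt], mul_pos_iff_of_pos_right hm,
    mul_eq_zero_iff_right hm.ne', by simp [mul_neg_iff, hm, hm.not_gt], by positivity⟩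
end

section
/- Let l, η, σ, α, γ > 0, E > 0, and fix an effective correlation c with 0 < c < 1 (as required in the lower-bound correlation-distorted regime, where c = ρ − φ > 0). Viewing the equilibrium quantities as functions of the Sharpe ratio S > 0 (i.e., with μ − r = Sσ and σ fixed), define Θ̂(S) := (γ(1−c²)η² + cSηE)/((l/α)γ(1−c²) + lE), X̂(S) := (1 − cS/(αη))·E/(γ(1−c²)/α + E), and Ŷ(S) := ((1/α + E/γ)·S − cη)·(E/σ)/(γ(1−c²)/α + E). Then for every S > 0: the derivative of Θ̂ at S is strictly positive, the derivative of X̂ at S is strictly negative, and the derivative of Ŷ at S is strictly positive. Hence in the lower-bound regime a higher Sharpe ratio always raises the insurance price, reduces underwriting, and increases the investment position. -/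
theorem deriv_eq_of_eq_affine {f : ℝ → ℝ} {a b : ℝ} (h : ∀ x, f x = a * x + b) (x : ℝ) :
    deriv f x = a := by
  rw [funext h]
  simp

/-- Comparative statics in the Sharpe ratio `S` within the lower-bound
correlation-distorted equilibrium at fixed effective correlation
`c ∈ (0, 1)`: a higher Sharpe ratio always raises the insurance price, reduces
underwriting, and increases the investment position. -/
theorem stmt_18 (l η σ α γ E c : ℝ)
    (hl : 0 < l) (hη : 0 < η) (hσ : 0 < σ) (hα : 0 < α) (hγ : 0 < γ)
    (hE : 0 < E) (hc0 : 0 < c) (hc1 : c < 1) :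
    let Θ : ℝ → ℝ := fun S =>
      (γ * (1 - c ^ 2) * η ^ 2 + c * S * η * E)
        / (l / α * γ * (1 - c ^ 2) + l * E)
    let X : ℝ → ℝ := fun S =>
      (1 - c * S / (α * η)) * E / (γ * (1 - c ^ 2) / α + E)
    let Y : ℝ → ℝ := fun S =>
      ((1 / α + E / γ) * S - c * η) * (E / σ) / (γ * (1 - c ^ 2) / α + E)
    ∀ S : ℝ, 0 < S →
      0 < deriv Θ S ∧ deriv X S < 0 ∧ 0 < deriv Y S := by
  intro Θ X Y S _
  have hc : 0 < 1 - c ^ 2 := by nlinarith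
  have hΘ : deriv Θ S = c * η * E / (l / α * γ * (1 - c ^ 2) + l * E) :=
    deriv_eq_of_eq_affine
      (b := γ * (1 - c ^ 2) * η ^ 2 / (l / α * γ * (1 - c ^ 2) + l * E))
      (fun x => by simp only [Θ]; ring) S
  have hX : deriv X S = -(c / (α * η) * E / (γ * (1 - c ^ 2) / α + E)) :=
    deriv_eq_of_eq_affine (b := E / (γ * (1 - c ^ 2) / α + E))
      (fun x => by simp only [X]; ring) S
  have hY : deriv Y S = (1 / α + E / γ) * (E / σ) / (γ * (1 - c ^ 2) / α + E) :=
    deriv_eq_of_eq_affine (b := -(c * η * (E / σ) / (γ * (1 - c ^ 2) / α + E)))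
      (fun x => by simp only [Y]; ring) S
  rw [hΘ, hX, hY, neg_lt_zero]
  refine ⟨?_, ?_, ?_⟩ <;> positivity
end

section
/- Let l, η, σ, γ > 0, μ > r, r ∈ ℝ, T > 0, θ > 0, m ∈ ℝ, ρ ∈ ℝ, φ > 0 with |ρ + φ| < 1 and |ρ − φ| < 1, set ψ := θlσ/(η(μ−r)), and assume φ ≥ ψ − ρ (the zero underwriting regime for a constant price θ). Define V(t, m) := −(1/γ)·exp(−γ·m·e^{r(T−t)} − (T−t)·(μ−r)²/(2σ²)) for (t, m) ∈ ℝ². Then V(T, m) = −(1/γ)e^{−γm} for all m; the partial derivatives satisfy ∂V/∂m(t, m) > 0 and ∂²V/∂m²(t, m) < 0 for all (t, m); and for every t ∈ [0, T] and m ∈ ℝ the Hamilton–Jacobi–Bellman–Isaacs equation holds: ∂V/∂t(t, m) + sup over x ≥ 0, y ∈ ℝ of (inf over ξ ∈ [−φ, φ] of { ∂V/∂m(t, m)·(xθl + y(μ−r) + mr) + (1/2)·∂²V/∂m²(t, m)·(x²η² + 2(ρ+ξ)xηyσ + y²σ²) }) = 0. -/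
/-- The insurer's static max-min problem: `A` and `B` stand for the first and second derivatives of
the value function in wealth. If the worst-case correlation rules out underwriting, the maximum is
attained at zero insurance supply and the Merton stock position. -/
lemma isGreatest_maxmin_hamiltonian {A B l η σ μ r θ ρ φ : ℝ} (c : ℝ)
    (hA : 0 < A) (hB : B < 0) (hη : 0 < η) (hσ : 0 < σ) (hμr : r < μ) (hφ : 0 < φ)
    (hup : |ρ + φ| < 1) (hlo : |ρ - φ| < 1)
    (hcase : θ * l * σ / (η * (μ - r)) - ρ ≤ φ) :
    IsGreatest ((fun p : ℝ × ℝ =>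
        sInf ((fun ξ =>
          A * (p.1 * θ * l + p.2 * (μ - r) + c)
            + 1 / 2 * B * (p.1 ^ 2 * η ^ 2 + 2 * (ρ + ξ) * p.1 * η * p.2 * σ
                + p.2 ^ 2 * σ ^ 2))
          '' Set.Icc (-φ) φ))
        '' {p : ℝ × ℝ | 0 ≤ p.1})
      (A * c - A ^ 2 * (μ - r) ^ 2 / (2 * B * σ ^ 2)) := by
  have hB' : B ≠ 0 := hB.ne
  have hd : 0 < μ - r := sub_pos.2 hμr
  constructor
  · refine ⟨(0, -(A * (μ - r) / (B * σ ^ 2))), le_refl (0 : ℝ), ?_⟩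
    have hconst : ∀ ξ : ℝ,
        A * (0 * θ * l + -(A * (μ - r) / (B * σ ^ 2)) * (μ - r) + c)
          + 1 / 2 * B * (0 ^ 2 * η ^ 2
            + 2 * (ρ + ξ) * 0 * η * -(A * (μ - r) / (B * σ ^ 2)) * σ
            + (-(A * (μ - r) / (B * σ ^ 2))) ^ 2 * σ ^ 2)
        = A * c - A ^ 2 * (μ - r) ^ 2 / (2 * B * σ ^ 2) := by
      intro ξ
      field_simp
      ring
    simp only [hconst]
    rw [Set.Nonempty.image_const ⟨0, by simp [hφ.le]⟩, csInf_singleton]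
  · rintro _ ⟨⟨x, y⟩, hx, rfl⟩
    change 0 ≤ x at hx
    obtain ⟨q, hq_mem, hq_ge, hq_abs⟩ : ∃ q : ℝ, q - ρ ∈ Set.Icc (-φ) φ ∧
        θ * l * σ / (η * (μ - r)) ≤ q ∧ |q| < 1 := by
      rw [abs_lt] at hup hlo
      refine ⟨max (θ * l * σ / (η * (μ - r))) (ρ - φ), ⟨?_, ?_⟩, le_max_left _ _,
        abs_lt.2 ⟨?_, ?_⟩⟩
      · linarith [le_max_right (θ * l * σ / (η * (μ - r))) (ρ - φ)]
      · rw [sub_le_iff_le_add]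
        exact max_le (by linarith) (by linarith)
      · exact lt_of_lt_of_le hlo.1 (le_max_right _ _)
      · exact max_lt (by linarith) hlo.2
    refine (csInf_le (isCompact_Icc.image (by fun_prop)).bddBelow
      (Set.mem_image_of_mem _ hq_mem)).trans ?_
    dsimp only
    have hprice : θ * l ≤ (μ - r) / σ * (q * η) := by
      rw [div_le_iff₀ (by positivity)] at hq_ge
      rw [div_mul_eq_mul_div, le_div_iff₀ hσ]
      linarith
    have hpremium : A * (x * (θ * l)) ≤ A * (x * ((μ - r) / σ * (q * η))) := by gcongr
    have hvar : 0 ≤ -B * ((1 - q ^ 2) * (η * x) ^ 2) := by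
      have : 0 ≤ 1 - q ^ 2 := by linarith [(sq_lt_one_iff_abs_lt_one q).2 hq_abs]
      have : 0 ≤ -B := by linarith
      positivity
    have hsquare : 0 ≤ -B * (q * η * x + σ * y + A * (μ - r) / (B * σ)) ^ 2 :=
      mul_nonneg (by linarith) (sq_nonneg _)
    have hexpand : A * c - A ^ 2 * (μ - r) ^ 2 / (2 * B * σ ^ 2)
        - (A * (x * θ * l + y * (μ - r) + c)
          + 1 / 2 * B * (x ^ 2 * η ^ 2 + 2 * (ρ + (q - ρ)) * x * η * y * σ + y ^ 2 * σ ^ 2))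
        = (A * (x * ((μ - r) / σ * (q * η))) - A * (x * (θ * l)))
          + 1 / 2 * (-B * ((1 - q ^ 2) * (η * x) ^ 2))
          + 1 / 2 * (-B * (q * η * x + σ * y + A * (μ - r) / (B * σ)) ^ 2) := by
      field_simp
      ring
    linarith


/-- In the zero underwriting regime (`φ ≥ ψ - ρ`) with constant price `θ`, the
candidate CARA value function
`V(t,m) = -(1/γ) exp(-γ m e^{r(T-t)} - (T-t)(μ-r)²/(2σ²))` satisfies the
terminal condition, has `V_m > 0`, `V_mm < 0`, and solves the HJBI equation. -/
theorem stmt_19 (l η σ γ μ r T θ ρ φ : ℝ)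
    (hl : 0 < l) (hη : 0 < η) (hσ : 0 < σ) (hγ : 0 < γ) (hμr : r < μ)
    (hT : 0 < T) (hθ : 0 < θ) (hφ : 0 < φ)
    (hup : |ρ + φ| < 1) (hlo : |ρ - φ| < 1)
    (hcase : φ ≥ θ * l * σ / (η * (μ - r)) - ρ) :
    let V : ℝ → ℝ → ℝ := fun t m =>
      -(1 / γ) * Real.exp (-(γ * m * Real.exp (r * (T - t)))
        - (T - t) * (μ - r) ^ 2 / (2 * σ ^ 2))
    (∀ m : ℝ, V T m = -(1 / γ) * Real.exp (-(γ * m))) ∧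
    (∀ t m : ℝ,
      0 < deriv (fun w => V t w) m ∧ deriv (deriv (fun w => V t w)) m < 0) ∧
    (∀ t ∈ Set.Icc (0 : ℝ) T, ∀ m : ℝ,
      deriv (fun τ => V τ m) t +
        sSup ((fun p : ℝ × ℝ =>
          sInf ((fun ξ =>
            deriv (fun w => V t w) m
                * (p.1 * θ * l + p.2 * (μ - r) + m * r)
              + 1 / 2 * deriv (deriv (fun w => V t w)) m
                * (p.1 ^ 2 * η ^ 2 + 2 * (ρ + ξ) * p.1 * η * p.2 * σ
                    + p.2 ^ 2 * σ ^ 2))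
            '' Set.Icc (-φ) φ))
          '' {p : ℝ × ℝ | 0 ≤ p.1}) = 0) := by
  intro V
  have hV_m : ∀ t m : ℝ, HasDerivAt (fun w => V t w)
      (Real.exp (r * (T - t)) * Real.exp (-(γ * m * Real.exp (r * (T - t)))
        - (T - t) * (μ - r) ^ 2 / (2 * σ ^ 2))) m := by
    intro t m
    refine (((((hasDerivAt_id' m).const_mul γ).mul_const (Real.exp (r * (T - t)))).neg.sub_const
      ((T - t) * (μ - r) ^ 2 / (2 * σ ^ 2))).exp.const_mul (-(1 / γ))).congr_deriv ?_
    simp only [Pi.neg_apply]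
    field_simp
  have hV_mm : ∀ t m : ℝ, HasDerivAt (deriv (fun w => V t w))
      (-(γ * Real.exp (r * (T - t)) ^ 2 * Real.exp (-(γ * m * Real.exp (r * (T - t)))
        - (T - t) * (μ - r) ^ 2 / (2 * σ ^ 2)))) m := by
    intro t m
    rw [funext fun w => (hV_m t w).deriv]
    refine (((((hasDerivAt_id' m).const_mul γ).mul_const (Real.exp (r * (T - t)))).neg.sub_const
      ((T - t) * (μ - r) ^ 2 / (2 * σ ^ 2))).exp.const_mul (Real.exp (r * (T - t)))).congr_deriv ?_
    simp only [Pi.neg_apply]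
    ring
  have hV_t : ∀ t m : ℝ, HasDerivAt (fun τ => V τ m)
      (-(1 / γ) * (Real.exp (-(γ * m * Real.exp (r * (T - t)))
        - (T - t) * (μ - r) ^ 2 / (2 * σ ^ 2))
        * (γ * m * r * Real.exp (r * (T - t)) + (μ - r) ^ 2 / (2 * σ ^ 2)))) t := by
    intro t m
    have hτ : HasDerivAt (fun τ : ℝ => T - τ) (-1) t := (hasDerivAt_id' t).const_sub T
    refine ((((hτ.const_mul r).exp.const_mul (γ * m)).neg.sub
      ((hτ.mul_const ((μ - r) ^ 2)).div_const (2 * σ ^ 2))).exp.const_mul (-(1 / γ))).congr_deriv ?_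
    simp only [Pi.neg_apply, Pi.sub_apply]
    ring
  refine ⟨fun m => by simp [V], fun t m => ⟨?_, ?_⟩, fun t _ m => ?_⟩
  · rw [(hV_m t m).deriv]
    positivity
  · rw [(hV_mm t m).deriv, neg_lt_zero]
    positivity
  · rw [(hV_m t m).deriv, (hV_mm t m).deriv, (hV_t t m).deriv,
      (isGreatest_maxmin_hamiltonian (m * r) (by positivity)
        (neg_lt_zero.2 (by positivity)) hη hσ hμr hφ hup hlo hcase).csSup_eq]
    generalize Real.exp (-(γ * m * Real.exp (r * (T - t)))
      - (T - t) * (μ - r) ^ 2 / (2 * σ ^ 2)) = X at *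
    field_simp
    ring
end
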